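/- arXiv:2509.11408 — 2 statements merged into one kernel-verified Lean document; each statement's English description precedes it below -/
import Mathlib

section
/- Suppose θ₁(p) ≠ 0, θ₁(t_a) ≠ 0 and θ₁(p−t_a) ≠ 0 for all a, and θ₁(t_a−t_b) ≠ 0 for all a ≠ b. Then the trace of the square of the elliptic framed Higgs field satisfies Tr(Φ(p)²) = Σ_{a} κ_a² − Σ_{a≠b} C_{ab}·C_{ba}·θ₁(p+t_a−t_b)·θ₁(p+t_b−t_a)·θ₁'(0)² / (θ₁(p)²·θ₁(t_a−t_b)²). -/
/-- The Jacobi theta function `θ₁(z|τ)`, defined from the two-variable Jacobi theta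
function: `θ₁(z) = -i · exp(iπτ/4 + iπz) · Θ₂(z + (1+τ)/2)`. -/
noncomputable def theta1 (τ z : ℂ) : ℂ :=
  -Complex.I * Complex.exp (Real.pi * Complex.I * τ / 4 + Real.pi * Complex.I * z) *
    jacobiTheta₂ (z + (1 + τ) / 2) τ

/-- The diagonal matrix `Θ(p) = diag(θ₁(p-t_a)/θ₁(t_a))`. -/
noncomputable def ThetaDiag (τ : ℂ) (n : ℕ) (t : Fin n → ℂ) (p : ℂ) :
    Matrix (Fin n) (Fin n) ℂ :=
  Matrix.diagonal fun a => theta1 τ (p - t a) / theta1 τ (t a)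

/-- The diagonal-free matrix `F(p)` with off-diagonal entries
`F_{ab}(p) = C_{ab} θ₁(p+t_a-t_b) θ₁'(0) / (θ₁(t_b-t_a) θ₁(p))`. -/
noncomputable def FMat (τ : ℂ) (n : ℕ) (t : Fin n → ℂ) (C : Matrix (Fin n) (Fin n) ℂ)
    (p : ℂ) : Matrix (Fin n) (Fin n) ℂ :=
  Matrix.of fun a b =>
    if a = b then 0 else
      C a b * theta1 τ (p + t a - t b) * deriv (theta1 τ) 0 /
        (theta1 τ (t b - t a) * theta1 τ p)

/-- The elliptic framed Higgs field `Φ(p) = H⁻¹ (K + Θ(p) F(p) Θ(p)⁻¹) H`. -/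
noncomputable def PhiEll (τ : ℂ) (n : ℕ) (κ t : Fin n → ℂ)
    (C H : Matrix (Fin n) (Fin n) ℂ) (p : ℂ) : Matrix (Fin n) (Fin n) ℂ :=
  H⁻¹ * (Matrix.diagonal κ + ThetaDiag τ n t p * FMat τ n t C p * (ThetaDiag τ n t p)⁻¹) * H

theorem theta1_neg (τ z : ℂ) : theta1 τ (-z) = -theta1 τ z := by
  have heven : jacobiTheta₂ (-z + (1 + τ) / 2) τ = jacobiTheta₂ (z + (1 - τ) / 2) τ := by
    rw [← jacobiTheta₂_neg_left, ← jacobiTheta₂_add_left]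
    congr 1
    ring
  have hshift : jacobiTheta₂ (z + (1 + τ) / 2) τ =
      -Complex.exp (-(2 * (Real.pi * Complex.I * z))) * jacobiTheta₂ (z + (1 - τ) / 2) τ := by
    rw [show z + (1 + τ) / 2 = z + (1 - τ) / 2 + τ by ring, jacobiTheta₂_add_left',
      show -(Real.pi : ℂ) * Complex.I * (τ + 2 * (z + (1 - τ) / 2)) =
        -(2 * (Real.pi * Complex.I * z)) - Real.pi * Complex.I by ring,
      Complex.exp_sub_pi_mul_I]
  have hexp : Complex.exp (Real.pi * Complex.I * τ / 4 + Real.pi * Complex.I * -z) =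
      Complex.exp (Real.pi * Complex.I * τ / 4 + Real.pi * Complex.I * z) *
        Complex.exp (-(2 * (Real.pi * Complex.I * z))) := by
    rw [← Complex.exp_add]
    congr 1
    ring
  rw [theta1, theta1, heven, hshift, hexp]
  ring

theorem Matrix.trace_mul_self_conj {ι R : Type*} [Fintype ι] [DecidableEq ι] [CommRing R]
    {P Q : Matrix ι ι R} (h : Q * P = 1) (A : Matrix ι ι R) :
    ((P * A * Q) * (P * A * Q)).trace = (A * A).trace := by
  have hPQ : P * A * Q * (P * A * Q) = P * (A * A * Q) := by
    calc P * A * Q * (P * A * Q) = P * A * (Q * P) * A * Q := by simp only [Matrix.mul_assoc]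
      _ = P * (A * A * Q) := by rw [h, Matrix.mul_one]; simp only [Matrix.mul_assoc]
  rw [hPQ, Matrix.trace_mul_comm, Matrix.mul_assoc, h, Matrix.mul_one]

theorem Matrix.trace_diagonal_add_mul_self {ι R : Type*} [Fintype ι] [DecidableEq ι] [CommRing R]
    (d : ι → R) {F : Matrix ι ι R} (hF : ∀ a, F a a = 0) :
    ((Matrix.diagonal d + F) * (Matrix.diagonal d + F)).trace =
      ∑ a, d a ^ 2 + ∑ a, ∑ b, F a b * F b a := by
  have hdF : (Matrix.diagonal d * F).trace = 0 := by
    simp [Matrix.trace, Matrix.diagonal_mul, hF]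
  rw [Matrix.add_mul, Matrix.mul_add, Matrix.mul_add, Matrix.trace_add, Matrix.trace_add,
    Matrix.trace_add, Matrix.trace_mul_comm F, hdF]
  simp [Matrix.trace, Matrix.diagonal_mul_diagonal, Matrix.mul_apply, sq]

theorem isUnit_det_ThetaDiag {τ : ℂ} {n : ℕ} {t : Fin n → ℂ} {p : ℂ}
    (ht : ∀ a, theta1 τ (t a) ≠ 0) (hpt : ∀ a, theta1 τ (p - t a) ≠ 0) :
    IsUnit (ThetaDiag τ n t p).det := by
  rw [ThetaDiag, Matrix.det_diagonal, isUnit_iff_ne_zero]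
  exact Finset.prod_ne_zero_iff.mpr fun a _ => div_ne_zero (hpt a) (ht a)

/-- Since `Θ(p)` commutes with the diagonal matrix `K`, it can be absorbed in the framing. -/
theorem PhiEll_eq_conj {τ : ℂ} {n : ℕ} {t : Fin n → ℂ} {p : ℂ} (κ : Fin n → ℂ)
    (C H : Matrix (Fin n) (Fin n) ℂ) (hD : IsUnit (ThetaDiag τ n t p).det) :
    PhiEll τ n κ t C H p =
      (H⁻¹ * ThetaDiag τ n t p) * (Matrix.diagonal κ + FMat τ n t C p) *
        ((ThetaDiag τ n t p)⁻¹ * H) := by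
  have hK : ThetaDiag τ n t p * Matrix.diagonal κ * (ThetaDiag τ n t p)⁻¹ =
      Matrix.diagonal κ := by
    have hcomm : ThetaDiag τ n t p * Matrix.diagonal κ =
        Matrix.diagonal κ * ThetaDiag τ n t p := by
      simp only [ThetaDiag, Matrix.diagonal_mul_diagonal, mul_comm]
    rw [hcomm, Matrix.mul_assoc, Matrix.mul_nonsing_inv _ hD, Matrix.mul_one]
  rw [PhiEll]
  nth_rewrite 1 [← hK]
  simp only [Matrix.mul_add, Matrix.add_mul, Matrix.mul_assoc]

theorem FMat_mul_FMat_swap (τ : ℂ) {n : ℕ} (t : Fin n → ℂ) (C : Matrix (Fin n) (Fin n) ℂ)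
    (p : ℂ) (a b : Fin n) :
    FMat τ n t C p a b * FMat τ n t C p b a =
      -(if a = b then 0 else
        C a b * C b a * theta1 τ (p + t a - t b) * theta1 τ (p + t b - t a) *
          (deriv (theta1 τ) 0) ^ 2 / ((theta1 τ p) ^ 2 * (theta1 τ (t a - t b)) ^ 2)) := by
  by_cases hab : a = b
  · simp [FMat, hab]
  · have hodd : theta1 τ (t b - t a) = -theta1 τ (t a - t b) := by
      rw [← theta1_neg, neg_sub]
    simp only [FMat, Matrix.of_apply, hab, Ne.symm hab, if_false, hodd]
    rw [div_mul_div_comm, ← div_neg]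
    congr 1 <;> ring

/-- The trace of the square of the elliptic framed Higgs field:
`Tr Φ(p)² = Σ κ_a² - Σ_{a≠b} C_{ab}C_{ba} θ₁(p+t_a-t_b)θ₁(p+t_b-t_a)θ₁'(0)²/(θ₁(p)²θ₁(t_a-t_b)²)`. -/
theorem trace_PhiEll_sq (τ : ℂ) (hτ : 0 < τ.im) (n : ℕ) (hn : 1 ≤ n)
    (κ t : Fin n → ℂ) (C H : Matrix (Fin n) (Fin n) ℂ)
    (hC : ∀ a, C a a = 0) (hH : IsUnit H) (p : ℂ)
    (hp : theta1 τ p ≠ 0) (ht : ∀ a, theta1 τ (t a) ≠ 0)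
    (hpt : ∀ a, theta1 τ (p - t a) ≠ 0)
    (htt : ∀ a b, a ≠ b → theta1 τ (t a - t b) ≠ 0) :
    (PhiEll τ n κ t C H p * PhiEll τ n κ t C H p).trace =
      (∑ a, κ a ^ 2) -
        ∑ a, ∑ b, (if a = b then 0 else
          C a b * C b a * theta1 τ (p + t a - t b) * theta1 τ (p + t b - t a) *
            (deriv (theta1 τ) 0) ^ 2 / ((theta1 τ p) ^ 2 * (theta1 τ (t a - t b)) ^ 2)) := by
  have hD := isUnit_det_ThetaDiag ht hpt
  have hH' : IsUnit H.det := (Matrix.isUnit_iff_isUnit_det H).mp hH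
  have hinv : (ThetaDiag τ n t p)⁻¹ * H * (H⁻¹ * ThetaDiag τ n t p) = 1 := by
    rw [Matrix.mul_assoc, Matrix.mul_nonsing_inv_cancel_left _ _ hH', Matrix.nonsing_inv_mul _ hD]
  rw [PhiEll_eq_conj κ C H hD, Matrix.trace_mul_self_conj hinv,
    Matrix.trace_diagonal_add_mul_self κ (fun a => by simp [FMat])]
  simp only [FMat_mul_FMat_swap, Finset.sum_neg_distrib, ← sub_eq_add_neg]
end

section
/- Fix an index j with θ₁(t_j) ≠ 0, θ₁(t_j−t_a) ≠ 0 and θ₁(t_a) ≠ 0 for all a ≠ j, and θ₁(t_a−t_b) ≠ 0 for all a ≠ b. Then for all indices a, b the limit of (p−t_j)·Φ_{ab}(p) as p → t_j (along p ≠ t_j) equals C_{ab}·δ_{bj}; that is, the residue of the gauge-fixed elliptic Higgs field at p = t_j is the rank-one matrix 𝐜_j·𝐞_jᵀ whose only nonzero column is the j-th column 𝐜_j of C (a traceless matrix, since C has zero diagonal). -/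
/-- The elliptic framed Higgs field in the gauge `𝐇 = 1`, with entries
`Φ_{ab}(p) = κ_a δ_{ab} + (1-δ_{ab}) C_{ab} θ₁(p-t_a)θ₁(p+t_a-t_b)θ₁'(0)θ₁(t_b) /
(θ₁(t_b-t_a)θ₁(p-t_b)θ₁(p)θ₁(t_a))`. -/
noncomputable def PhiGauge (τ : ℂ) (n : ℕ) (κ t : Fin n → ℂ)
    (C : Matrix (Fin n) (Fin n) ℂ) (p : ℂ) (a b : Fin n) : ℂ :=
  κ a * (if a = b then 1 else 0) +
    (if a = b then 0 else 1) * C a b *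
      theta1 τ (p - t a) * theta1 τ (p + t a - t b) * deriv (theta1 τ) 0 * theta1 τ (t b) /
        (theta1 τ (t b - t a) * theta1 τ (p - t b) * theta1 τ p * theta1 τ (t a))

/-- The map `(k, l) ↦ (k + l, k - l)` and its shift by `(1, 0)` together enumerate `ℤ × ℤ`,
according to the parity of the sum of the coordinates. -/
lemma bijective_sumElim_add_sub :
    Function.Bijective (Sum.elim (fun q : ℤ × ℤ => (q.1 + q.2, q.1 - q.2))
      (fun q : ℤ × ℤ => (q.1 + q.2 + 1, q.1 - q.2))) := by
  constructor
  · rintro (⟨k, l⟩ | ⟨k, l⟩) (⟨k', l'⟩ | ⟨k', l'⟩) h <;>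
      simp only [Sum.elim_inl, Sum.elim_inr, Prod.mk.injEq] at h
    · simp only [Sum.inl.injEq, Prod.mk.injEq]; omega
    · omega
    · omega
    · simp only [Sum.inr.injEq, Prod.mk.injEq]; omega
  · rintro ⟨m, n⟩
    rcases Int.even_or_odd (m + n) with ⟨k, hk⟩ | ⟨k, hk⟩
    · exact ⟨Sum.inl (k, k - n), by simp only [Sum.elim_inl, Prod.mk.injEq]; omega⟩
    · exact ⟨Sum.inr (k, k - n), by simp only [Sum.elim_inr, Prod.mk.injEq]; omega⟩

/-- The theta function of half-integral characteristic with modulus `2τ` and argument `2x`. -/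
noncomputable def thetaHalf (τ x : ℂ) : ℂ :=
  Complex.exp (Real.pi * Complex.I * τ / 2 + 2 * Real.pi * Complex.I * x) *
    jacobiTheta₂ (2 * x + τ) (2 * τ)

lemma jacobiTheta₂_add_mul_jacobiTheta₂_sub {τ : ℂ} (hτ : 0 < τ.im) (x y : ℂ) :
    jacobiTheta₂ (x + y) τ * jacobiTheta₂ (x - y) τ =
      jacobiTheta₂ (2 * x) (2 * τ) * jacobiTheta₂ (2 * y) (2 * τ) +
        thetaHalf τ x * thetaHalf τ y := by
  have hτ2 : 0 < (2 * τ).im := by simpa using hτ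
  have hmul : ∀ {f g : ℤ → ℂ} {u v : ℂ}, HasSum f u → HasSum g v →
      HasSum (fun q : ℤ × ℤ => f q.1 * g q.2) (u * v) := fun hf hg =>
    hf.mul hg (summable_mul_of_summable_norm hf.summable.norm hg.summable.norm)
  have hL := hmul (hasSum_jacobiTheta₂_term (x + y) hτ) (hasSum_jacobiTheta₂_term (x - y) hτ)
  have hE := hmul (hasSum_jacobiTheta₂_term (2 * x) hτ2) (hasSum_jacobiTheta₂_term (2 * y) hτ2)
  have hO := hmul
    ((hasSum_jacobiTheta₂_term (2 * x + τ) hτ2).mul_left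
      (Complex.exp (Real.pi * Complex.I * τ / 2 + 2 * Real.pi * Complex.I * x)))
    ((hasSum_jacobiTheta₂_term (2 * y + τ) hτ2).mul_left
      (Complex.exp (Real.pi * Complex.I * τ / 2 + 2 * Real.pi * Complex.I * y)))
  rw [← (Equiv.ofBijective _ bijective_sumElim_add_sub).hasSum_iff] at hL
  refine hL.unique (HasSum.sum ?_ ?_)
  · convert hE using 2 with q
    simp only [Function.comp_apply, Equiv.ofBijective_apply, Sum.elim_inl, jacobiTheta₂_term,
      ← Complex.exp_add]
    congr 1
    push_cast
    ring
  · rw [thetaHalf, thetaHalf]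
    convert hO using 2 with q
    simp only [Function.comp_apply, Equiv.ofBijective_apply, Sum.elim_inr, jacobiTheta₂_term,
      ← Complex.exp_add]
    congr 1
    push_cast
    ring

lemma jacobiTheta₂_two_mul_add_half_period (τ z : ℂ) :
    jacobiTheta₂ (2 * (z + (1 + τ) / 2)) (2 * τ) =
      Complex.exp (-(Real.pi * Complex.I * τ / 2 + 2 * Real.pi * Complex.I * z)) *
        thetaHalf τ z := by
  rw [thetaHalf, ← mul_assoc, ← Complex.exp_add, neg_add_cancel, Complex.exp_zero, one_mul,
    ← jacobiTheta₂_add_left (2 * z + τ)]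
  congr 1
  ring

lemma thetaHalf_add_half_period (τ z : ℂ) :
    thetaHalf τ (z + (1 + τ) / 2) =
      -Complex.exp (-(Real.pi * Complex.I * τ / 2 + 2 * Real.pi * Complex.I * z)) *
        jacobiTheta₂ (2 * z) (2 * τ) := by
  have h : 2 * (z + (1 + τ) / 2) + τ = 2 * z + 2 * τ + 1 := by ring
  rw [thetaHalf, h, jacobiTheta₂_add_left, jacobiTheta₂_add_left', ← mul_assoc,
    ← Complex.exp_add, ← neg_one_mul (Complex.exp _), ← Complex.exp_pi_mul_I, ← Complex.exp_add]
  congr 2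
  ring

/-- The addition formula expressing `θ₁(z + a) θ₁(z - a)` through theta functions of modulus
`2τ`. -/
lemma theta1_add_mul_theta1_sub {τ : ℂ} (hτ : 0 < τ.im) (z a : ℂ) :
    theta1 τ (z + a) * theta1 τ (z - a) =
      jacobiTheta₂ (2 * z) (2 * τ) * thetaHalf τ a -
        thetaHalf τ z * jacobiTheta₂ (2 * a) (2 * τ) := by
  have h := jacobiTheta₂_add_mul_jacobiTheta₂_sub hτ (z + (1 + τ) / 2) a
  rw [jacobiTheta₂_two_mul_add_half_period, thetaHalf_add_half_period] at h
  have h1 : z + a + (1 + τ) / 2 = z + (1 + τ) / 2 + a := by ring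
  have h2 : z - a + (1 + τ) / 2 = z + (1 + τ) / 2 - a := by ring
  have h3 : Complex.exp (Real.pi * Complex.I * τ / 4 + Real.pi * Complex.I * (z + a)) *
      Complex.exp (Real.pi * Complex.I * τ / 4 + Real.pi * Complex.I * (z - a)) =
      Complex.exp (Real.pi * Complex.I * τ / 2 + 2 * Real.pi * Complex.I * z) := by
    rw [← Complex.exp_add]
    congr 1
    ring
  have h4 : Complex.exp (Real.pi * Complex.I * τ / 2 + 2 * Real.pi * Complex.I * z) *
      Complex.exp (-(Real.pi * Complex.I * τ / 2 + 2 * Real.pi * Complex.I * z)) = 1 := by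
    rw [← Complex.exp_add, add_neg_cancel, Complex.exp_zero]
  rw [theta1, theta1, h1, h2]
  calc _ = Complex.I ^ 2 *
        (Complex.exp (Real.pi * Complex.I * τ / 4 + Real.pi * Complex.I * (z + a)) *
        Complex.exp (Real.pi * Complex.I * τ / 4 + Real.pi * Complex.I * (z - a))) *
        (jacobiTheta₂ (z + (1 + τ) / 2 + a) τ * jacobiTheta₂ (z + (1 + τ) / 2 - a) τ) := by ring
    _ = _ := by
      rw [h3, h, Complex.I_sq]
      linear_combination (jacobiTheta₂ (2 * z) (2 * τ) * thetaHalf τ a -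
        thetaHalf τ z * jacobiTheta₂ (2 * a) (2 * τ)) * h4

lemma theta1_zero {τ : ℂ} (hτ : 0 < τ.im) : theta1 τ 0 = 0 := by
  have h := theta1_add_mul_theta1_sub hτ 0 0
  rw [add_zero, sub_zero, mul_comm (thetaHalf τ 0), sub_self] at h
  exact mul_self_eq_zero.mp h

lemma differentiable_jacobiTheta₂_fst {τ : ℂ} (hτ : 0 < τ.im) :
    Differentiable ℂ (jacobiTheta₂ · τ) :=
  fun z => differentiableAt_jacobiTheta₂_fst z hτ

lemma differentiable_theta1 {τ : ℂ} (hτ : 0 < τ.im) : Differentiable ℂ (theta1 τ) := by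
  have h : Differentiable ℂ fun z => jacobiTheta₂ (z + (1 + τ) / 2) τ :=
    (differentiable_jacobiTheta₂_fst hτ).comp (by fun_prop : Differentiable ℂ (· + (1 + τ) / 2))
  unfold theta1
  fun_prop

lemma differentiable_thetaHalf {τ : ℂ} (hτ : 0 < τ.im) : Differentiable ℂ (thetaHalf τ) := by
  have hτ2 : 0 < (2 * τ).im := by simpa using hτ
  have h : Differentiable ℂ fun z => jacobiTheta₂ (2 * z + τ) (2 * τ) :=
    (differentiable_jacobiTheta₂_fst hτ2).comp (by fun_prop : Differentiable ℂ (2 * · + τ))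
  unfold thetaHalf
  fun_prop

/-- Two entire functions with vanishing Wronskian are proportional. -/
lemma mul_eq_mul_of_wronskian_eq_zero {f g : ℂ → ℂ} (hf : Differentiable ℂ f)
    (hg : Differentiable ℂ g) (hW : ∀ z, deriv f z * g z - deriv g z * f z = 0) (z a : ℂ) :
    f z * g a = g z * f a := by
  by_cases h0 : ∀ z, g z = 0
  · simp [h0]
  push Not at h0
  obtain ⟨w, hw⟩ := h0
  obtain ⟨r, hr, hball⟩ := Metric.eventually_nhds_iff_ball.mp
    (hg.continuous.continuousAt.eventually_ne hw)
  have hconst : ∀ x ∈ Metric.ball w r, f x / g x = f w / g w := fun x hx => by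
    refine Metric.isOpen_ball.is_const_of_deriv_eq_zero (𝕜 := ℂ)
      (f := fun x => f x / g x) (convex_ball w r).isPreconnected
      (fun y hy => ((hf y).div (hg y) (hball y hy)).differentiableWithinAt)
      (fun y hy => ?_) hx (Metric.mem_ball_self hr)
    rw [deriv_fun_div (hf y) (hg y) (hball y hy), mul_comm (f y), hW y, zero_div]
    rfl
  have hprop : f = fun x => f w / g w * g x := by
    refine AnalyticOnNhd.eq_of_eventuallyEq (𝕜 := ℂ) (z₀ := w) (fun x _ => hf.analyticAt x)
      (fun x _ => (hg.const_mul _).analyticAt x) ?_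
    filter_upwards [Metric.ball_mem_nhds w hr] with x hx
    rw [← hconst x hx, div_mul_cancel₀ _ (hball x hx)]
  rw [hprop]
  ring

/-- The zero of `θ₁` at the origin is simple. -/
lemma deriv_theta1_zero_ne_zero {τ : ℂ} (hτ : 0 < τ.im) {w : ℂ} (hw : theta1 τ w ≠ 0) :
    deriv (theta1 τ) 0 ≠ 0 := by
  intro hd
  have hθ := differentiable_theta1 hτ
  have hτ2 : 0 < (2 * τ).im := by simpa using hτ
  have hA : Differentiable ℂ fun z => jacobiTheta₂ (2 * z) (2 * τ) :=
    (differentiable_jacobiTheta₂_fst hτ2).comp (by fun_prop : Differentiable ℂ fun z : ℂ => 2 * z)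
  have hB := differentiable_thetaHalf hτ
  have hW : ∀ a, deriv (fun z => jacobiTheta₂ (2 * z) (2 * τ)) a * thetaHalf τ a -
      deriv (thetaHalf τ) a * jacobiTheta₂ (2 * a) (2 * τ) = 0 := fun a => by
    have hR := ((hA a).hasDerivAt.mul_const (thetaHalf τ a)).sub
      ((hB a).hasDerivAt.mul_const (jacobiTheta₂ (2 * a) (2 * τ)))
    have h0 : HasDerivAt (theta1 τ) 0 (a - a) := by
      rw [sub_self]
      simpa [hd] using (hθ 0).hasDerivAt
    have hL := ((hθ (a + a)).hasDerivAt.comp_add_const a a).mul (h0.comp_sub_const a a)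
    rw [mul_zero, sub_self, theta1_zero hτ, mul_zero, add_zero] at hL
    refine hR.unique (hL.congr_of_eventuallyEq (.of_forall fun z => ?_))
    exact (theta1_add_mul_theta1_sub hτ z a).symm
  have h := theta1_add_mul_theta1_sub hτ w 0
  rw [mul_eq_mul_of_wronskian_eq_zero hA hB hW w 0, sub_self, add_zero, sub_zero] at h
  exact hw (mul_self_eq_zero.mp h)

/-- The residue of the gauge-fixed elliptic Higgs field at `p = t_j`:
`lim_{p → t_j} (p - t_j) Φ_{ab}(p) = C_{ab} δ_{bj}`, i.e. the residue is the rank-one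
matrix `𝐜_j 𝐞_jᵀ` whose only nonzero column is the `j`-th column of `C`. -/
theorem PhiGauge_residue (τ : ℂ) (hτ : 0 < τ.im) (n : ℕ) (hn : 1 ≤ n)
    (κ t : Fin n → ℂ) (C : Matrix (Fin n) (Fin n) ℂ) (hC : ∀ a, C a a = 0)
    (j : Fin n) (htj : theta1 τ (t j) ≠ 0)
    (htja : ∀ a, a ≠ j → theta1 τ (t j - t a) ≠ 0)
    (hta : ∀ a, a ≠ j → theta1 τ (t a) ≠ 0)
    (htt : ∀ a b, a ≠ b → theta1 τ (t a - t b) ≠ 0)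
    (a b : Fin n) :
    Filter.Tendsto (fun p => (p - t j) * PhiGauge τ n κ t C p a b)
      (nhdsWithin (t j) {t j}ᶜ)
      (nhds (C a b * (if b = j then 1 else 0))) := by
  have hθ := differentiable_theta1 hτ
  have hid : Filter.Tendsto (fun p => p - t j) (nhdsWithin (t j) {t j}ᶜ) (nhds 0) := by
    have : ContinuousAt (fun p : ℂ => p - t j) (t j) := by fun_prop
    simpa using this.tendsto.mono_left nhdsWithin_le_nhds
  have hta' : ∀ a, theta1 τ (t a) ≠ 0 := fun a => by
    rcases eq_or_ne a j with rfl | h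
    exacts [htj, hta a h]
  have hcont : Continuous (theta1 τ) := hθ.continuous
  rcases eq_or_ne a b with rfl | hab
  · simpa [PhiGauge, hC] using hid.mul_const (κ a)
  have hba := htt b a hab.symm
  simp only [PhiGauge, if_neg hab, mul_zero, zero_add, one_mul]
  rcases eq_or_ne b j with rfl | hbj
  · have hd := deriv_theta1_zero_ne_zero hτ htj
    have hslope : Filter.Tendsto (fun p => (p - t b) / theta1 τ (p - t b))
        (nhdsWithin (t b) {t b}ᶜ) (nhds (deriv (theta1 τ) 0)⁻¹) := by
      have h0 : HasDerivAt (theta1 τ) (deriv (theta1 τ) 0) (t b - t b) := by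
        rw [sub_self]
        exact (hθ 0).hasDerivAt
      refine ((h0.comp_sub_const (t b) (t b)).tendsto_slope.inv₀ hd).congr fun p => ?_
      rw [slope_def_field, sub_self, theta1_zero hτ, sub_zero, inv_div]
    have hden : theta1 τ (t b - t a) * theta1 τ (t b) * theta1 τ (t a) ≠ 0 :=
      mul_ne_zero (mul_ne_zero hba htj) (hta' a)
    have hrest : ContinuousAt (fun p => C a b * theta1 τ (p - t a) * theta1 τ (p + t a - t b) *
        deriv (theta1 τ) 0 * theta1 τ (t b) /
          (theta1 τ (t b - t a) * theta1 τ p * theta1 τ (t a))) (t b) :=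
      ContinuousAt.div₀ (by fun_prop) (by fun_prop) hden
    convert hslope.mul (hrest.tendsto.mono_left nhdsWithin_le_nhds) using 2 with p
    · simp only [div_eq_mul_inv, mul_inv]
      ring
    · have := hta' a
      rw [add_sub_cancel_left]
      field_simp
      simp
  · have hden : theta1 τ (t b - t a) * theta1 τ (t j - t b) * theta1 τ (t j) *
        theta1 τ (t a) ≠ 0 :=
      mul_ne_zero (mul_ne_zero (mul_ne_zero hba (htja b hbj)) htj) (hta' a)
    have hrest : ContinuousAt (fun p => C a b * theta1 τ (p - t a) * theta1 τ (p + t a - t b) *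
        deriv (theta1 τ) 0 * theta1 τ (t b) /
          (theta1 τ (t b - t a) * theta1 τ (p - t b) * theta1 τ p * theta1 τ (t a))) (t j) :=
      ContinuousAt.div₀ (by fun_prop) (by fun_prop) hden
    simpa [hbj] using hid.mul (hrest.tendsto.mono_left nhdsWithin_le_nhds)
end
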